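/- arXiv:2601.13072 — 5 statements merged into one kernel-verified Lean document; each statement's English description precedes it below -/
import Mathlib

section
/- Let G be a finite simple graph with list assignment L : V(G) → 2^{{1,2,3}}, and let u ∈ V(G) be a vertex with L(u) = {1,2,3}. Let M = N_{L_3}(N_{L_2}(N_{L_2}(u))) be the set of vertices v with |L(v)| = 3 for which there is a path u–x–y–v in G with |L(x)| = |L(y)| = 2. Then there exist a colour c ∈ L(u), a subset W ⊆ M with 3·|W| ≥ |M|, and a function d : W → {1,2,3} with d(v) ∈ L(v) for every v ∈ W, such that every proper L-colouring φ of G with φ(u) = c satisfies φ(v) ≠ d(v) for all v ∈ W. -/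
open Set

/-- Two 2-element subsets of `Fin 3` can be written as `{c, b}` and `{b, d}`. -/
theorem exists_eq_pair_eq_pair_of_card_eq_two :
    ∀ A B : Finset (Fin 3), A.card = 2 → B.card = 2 →
      ∃ c b d : Fin 3, A = {c, b} ∧ B = {b, d} := by
  decide

/-- Along a path `u - x - y - v` whose inner vertices have lists of size two, some colour at `u`
forbids some colour at `v`. -/
theorem exists_forced_ne_of_path {V : Type*} (G : SimpleGraph V) (L : V → Finset (Fin 3))
    {u x y v : V} (hx : (L x).card = 2) (hy : (L y).card = 2)
    (hux : G.Adj u x) (hxy : G.Adj x y) (hyv : G.Adj y v) :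
    ∃ c d : Fin 3, ∀ φ : V → Fin 3, (∀ a b : V, G.Adj a b → φ a ≠ φ b) →
      (∀ w : V, φ w ∈ L w) → φ u = c → φ v ≠ d := by
  obtain ⟨c, b, d, hA, hB⟩ := exists_eq_pair_eq_pair_of_card_eq_two _ _ hx hy
  refine ⟨c, d, fun φ hφ hL hc hd => ?_⟩
  have h1 := hφ _ _ hux
  have h2 := hφ _ _ hxy
  have h3 := hφ _ _ hyv
  have h4 := hL x
  have h5 := hL y
  rw [hA, Finset.mem_insert, Finset.mem_singleton] at h4
  rw [hB, Finset.mem_insert, Finset.mem_singleton] at h5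
  grind

/-- Pigeonhole for a colouring of a finite set by three colours. -/
theorem exists_ncard_le_three_mul_ncard_fiber {V : Type*} {M : Set V} (hM : M.Finite)
    (f : V → Fin 3) : ∃ c : Fin 3, M.ncard ≤ 3 * {v ∈ M | f v = c}.ncard := by
  classical
  lift M to Finset V using hM
  have hsum := Finset.card_eq_sum_card_fiberwise (s := M) (t := Finset.univ) (f := f)
    (fun _ _ => by simp)
  have hfiber (c : Fin 3) :
      {v ∈ (M : Set V) | f v = c}.ncard = (M.filter fun v => f v = c).card := by
    rw [← Set.ncard_coe_finset]
    simp
  rw [Fin.sum_univ_three] at hsum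
  simp only [hfiber, Set.ncard_coe_finset]
  by_contra! h
  have h0 := h 0
  have h1 := h 1
  have h2 := h 2
  omega

/-- Given a vertex `u` with full list, there is a colour `c ∈ L u`, a subset
`W` of `M := N_{L₃}(N_{L₂}(N_{L₂}(u)))` with `3|W| ≥ |M|`, and forbidden colours
`d v ∈ L v` for `v ∈ W`, such that any proper `L`-colouring assigning `c` to `u`
avoids `d v` on every `v ∈ W`. -/
theorem stmt_0 {V : Type*} [Fintype V] (G : SimpleGraph V) (L : V → Finset (Fin 3))
    (u : V) (hu : L u = Finset.univ)
    (M : Set V)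
    (hM : M = {v : V | (L v).card = 3 ∧ v ≠ u ∧ ∃ x y : V,
      (L x).card = 2 ∧ (L y).card = 2 ∧ G.Adj u x ∧ G.Adj x y ∧ G.Adj y v}) :
    ∃ c ∈ L u, ∃ W ⊆ M, ∃ d : V → Fin 3,
      M.ncard ≤ 3 * W.ncard ∧ (∀ v ∈ W, d v ∈ L v) ∧
      ∀ φ : V → Fin 3, (∀ a b : V, G.Adj a b → φ a ≠ φ b) → (∀ w : V, φ w ∈ L w) →
        φ u = c → ∀ v ∈ W, φ v ≠ d v := by
  have key : ∀ v : V, ∃ c d : Fin 3, v ∈ M → ∀ φ : V → Fin 3,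
      (∀ a b : V, G.Adj a b → φ a ≠ φ b) → (∀ w : V, φ w ∈ L w) → φ u = c → φ v ≠ d := by
    intro v
    by_cases hv : v ∈ M
    · have hv' := hv
      rw [hM] at hv'
      obtain ⟨-, -, x, y, hx, hy, hux, hxy, hyv⟩ := hv'
      obtain ⟨c, d, h⟩ := exists_forced_ne_of_path G L hx hy hux hxy hyv
      exact ⟨c, d, fun _ => h⟩
    · exact ⟨0, 0, fun h => absurd h hv⟩
  choose f d hfd using key
  obtain ⟨c, hc⟩ := exists_ncard_le_three_mul_ncard_fiber M.toFinite f
  refine ⟨c, by simp [hu], {v ∈ M | f v = c}, fun v hv => hv.1, d, hc, fun v hv => ?_, ?_⟩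
  · have hv' := hv.1
    rw [hM] at hv'
    have hLv : L v = Finset.univ := (Finset.card_eq_iff_eq_univ _).1 (by simpa using hv'.1)
    simp [hLv]
  · intro φ hφ hL huc v hv
    exact hfd v hv.1 φ hφ hL (huc.trans hv.2.symm)
end

section
/- Let ε ∈ (0, 1/33). There exists ℓ > 0 such that the following holds for all μ ≥ ℓ. Let H be a finite simple graph on μ vertices such that for each vertex v ∈ V(H): |N(v)| ≤ μ^{1/3+ε}, |N^{(2)}(v)| ≤ μ^{2/3+2ε}, and |N^{(≤3)}(v)| ≥ μ − 4μ^{2/3+2ε}; and such that for all pairs of distinct vertices u, v ∈ V(H): |N(N(u) ∩ N(v))| ≤ μ^{1/3+ε}. Let r ∈ V(H); for each a ∈ N^{(3)}(r) fix a vertex n_r(a) ∈ N(a) ∩ N^{(2)}(r); and for each v ∈ V(H) and each x ∈ N^{(2)}(v) fix a vertex p_v(x) ∈ N(v) ∩ N(x). Then for every proper 3-colouring φ : V(H) → {1,2,3} of H, at least one of the following holds: (a) there exist disjoint sets T, T̃ ⊆ V(H), each of size at most 2μ^{2/3−ε}, and colours i ≠ j, such that φ takes the constant value i on T and the constant value j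 on T̃, and |N(N[T] ∩ N[T̃])| ≥ μ/7; or (b) there exists a vertex v ∈ V(H) such that |{x ∈ N^{(2)}(v) : p_v(x) ∉ N^{(3)}(r) or φ(n_r(p_v(x))) ≠ φ(x)}| ≤ 3μ^{2/3−ε}. -/
open Set

/-- The open neighbourhood of a vertex set: vertices outside `S` with a neighbour in `S`. -/
def nbhd {V : Type*} (G : SimpleGraph V) (S : Set V) : Set V :=
  {v : V | v ∉ S ∧ ∃ u ∈ S, G.Adj u v}

/-- The closed neighbourhood of a vertex set. -/
def cnbhd {V : Type*} (G : SimpleGraph V) (S : Set V) : Set V :=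
  S ∪ nbhd G S

/-- Greedy derandomisation: every set of size at most `m * k` has a subset of size at most `m`
which captures, in the exponential average, a `1 / (2 * k)` share of every bounded weight. -/
theorem exists_subset_sum_exp_le {α V : Type*} (B : Finset α) {k : ℕ} (hk : 0 < k)
    (w : α → V → ℝ) (m : ℕ) (A : Finset V) (c : α → ℝ) (hc : ∀ v ∈ B, 0 ≤ c v)
    (hA : A.card ≤ m * k) (hw : ∀ v ∈ B, ∀ a ∈ A, 0 ≤ w v a ∧ w v a ≤ 1) :
    ∃ T ⊆ A, T.card ≤ m ∧
      ∑ v ∈ B, c v * Real.exp (-∑ a ∈ T, w v a) ≤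
        ∑ v ∈ B, c v * Real.exp (-(∑ a ∈ A, w v a) / (2 * k)) := by
  classical
  induction m generalizing A c with
  | zero =>
    obtain rfl : A = ∅ := by simpa using hA
    exact ⟨∅, by simp, by simp, by simp⟩
  | succ m ih =>
    rcases A.eq_empty_or_nonempty with rfl | hne
    · exact ⟨∅, by simp, by simp, by simp⟩
    obtain ⟨A₀, hA₀, hcard⟩ := Finset.exists_subset_card_eq (min_le_right k A.card)
    have hA₀pos : 0 < A₀.card := by
      rw [hcard]; exact lt_min hk hne.card_pos
    have hA₀k : A₀.card ≤ k := hcard ▸ min_le_left _ _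
    have hrest : (A \ A₀).card ≤ m * k := by
      rw [Finset.card_sdiff_of_subset hA₀, hcard]
      rcases le_total k A.card with h | h
      · rw [min_eq_left h]; rw [add_mul, one_mul] at hA; omega
      · rw [min_eq_right h]; simp
    have hkR : (0 : ℝ) < k := by exact_mod_cast hk
    have hA₀R : (0 : ℝ) < A₀.card := by exact_mod_cast hA₀pos
    have hA₀kR : (A₀.card : ℝ) ≤ k := by exact_mod_cast hA₀k
    have hexp : ∀ y : ℝ, 0 ≤ y → y ≤ 1 → Real.exp (-y) ≤ 1 - y / 2 := by
      intro y h0 h1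
      rw [Real.exp_neg, inv_le_iff_one_le_mul₀ (Real.exp_pos y)]
      have := Real.add_one_le_exp y
      nlinarith
    have havg : ∀ v ∈ B, ∑ a ∈ A₀, Real.exp (-w v a) ≤
        A₀.card * Real.exp (-(∑ a ∈ A₀, w v a) / (2 * k)) := by
      intro v hv
      have hs0 : 0 ≤ ∑ a ∈ A₀, w v a :=
        Finset.sum_nonneg fun a ha ↦ (hw v hv a (hA₀ ha)).1
      calc ∑ a ∈ A₀, Real.exp (-w v a) ≤ ∑ a ∈ A₀, (1 - w v a / 2) :=
            Finset.sum_le_sum fun a ha ↦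
              hexp _ (hw v hv a (hA₀ ha)).1 (hw v hv a (hA₀ ha)).2
        _ = A₀.card - (∑ a ∈ A₀, w v a) / 2 := by
            rw [Finset.sum_sub_distrib, ← Finset.sum_div]; simp
        _ = A₀.card * (1 - (∑ a ∈ A₀, w v a) / (2 * A₀.card)) := by field_simp
        _ ≤ A₀.card * (1 - (∑ a ∈ A₀, w v a) / (2 * k)) := by gcongr
        _ ≤ _ := by
            gcongr
            have := Real.add_one_le_exp (-(∑ a ∈ A₀, w v a) / (2 * k))
            rw [neg_div] at this ⊢
            linarith
    let R : α → ℝ := fun v ↦ Real.exp (-(∑ a ∈ A \ A₀, w v a) / (2 * k))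
    have hsplit : ∀ v, Real.exp (-(∑ a ∈ A, w v a) / (2 * k)) =
        Real.exp (-(∑ a ∈ A₀, w v a) / (2 * k)) * R v := by
      intro v
      rw [← Real.exp_add, ← Finset.sum_sdiff hA₀]
      congr 1; ring
    obtain ⟨a, ha, hale⟩ : ∃ a ∈ A₀, ∑ v ∈ B, c v * Real.exp (-w v a) * R v ≤
        ∑ v ∈ B, c v * Real.exp (-(∑ a ∈ A, w v a) / (2 * k)) := by
      refine Finset.exists_le_of_sum_le (Finset.card_pos.1 hA₀pos) ?_
      rw [Finset.sum_comm, Finset.sum_const, nsmul_eq_mul, Finset.mul_sum]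
      refine Finset.sum_le_sum fun v hv ↦ ?_
      have hR : 0 ≤ c v * R v := mul_nonneg (hc v hv) (Real.exp_pos _).le
      calc ∑ a ∈ A₀, c v * Real.exp (-w v a) * R v
          = (c v * R v) * ∑ a ∈ A₀, Real.exp (-w v a) := by
            rw [Finset.mul_sum]; exact Finset.sum_congr rfl fun _ _ ↦ by ring
        _ ≤ (c v * R v) * (A₀.card * Real.exp (-(∑ a ∈ A₀, w v a) / (2 * k))) := by
            gcongr; exact havg v hv
        _ = _ := by rw [hsplit]; ring
    obtain ⟨T, hTA, hTm, hT⟩ := ih (A \ A₀) (fun v ↦ c v * Real.exp (-w v a))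
      (fun v hv ↦ mul_nonneg (hc v hv) (Real.exp_pos _).le) hrest
      fun v hv b hb ↦ hw v hv b (Finset.mem_sdiff.1 hb).1
    have haT : a ∉ T := fun h ↦ (Finset.mem_sdiff.1 (hTA h)).2 ha
    refine ⟨insert a T, Finset.insert_subset (hA₀ ha) (hTA.trans Finset.sdiff_subset), ?_, ?_⟩
    · rw [Finset.card_insert_of_notMem haT]; omega
    · refine le_trans (le_of_eq ?_) (hT.trans hale)
      refine Finset.sum_congr rfl fun v _ ↦ ?_
      rw [Finset.sum_insert haT, neg_add, Real.exp_add, mul_assoc]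

open Classical in
/-- If each `v ∈ B` comes with a set `Y v ⊆ C` and a map `g v : Y v → A` with small fibres, then
there are small `T ⊆ A` and `S ⊆ C` such that for all but few `v ∈ B` some `x ∈ Y v ∩ S` has
`g v x ∈ T`. -/
theorem exists_subsets_card_not_hit_le {α V : Type*} (B : Finset α) (A C : Finset V)
    {k k' m m' : ℕ} (hk : 0 < k) (hk' : 0 < k') (hA : A.card ≤ m * k) (hC : C.card ≤ m' * k')
    (Y : α → Finset V) (g : α → V → V) (hY : ∀ v ∈ B, Y v ⊆ C)
    (hg : ∀ v ∈ B, ∀ x ∈ Y v, g v x ∈ A)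
    (hfib : ∀ v ∈ B, ∀ a ∈ A, ((Y v).filter fun x ↦ g v x = a).card ≤ 2 * k') :
    ∃ T ⊆ A, ∃ S ⊆ C, T.card ≤ m ∧ S.card ≤ m' ∧
      ((B.filter fun v ↦ ∀ x ∈ Y v, x ∈ S → g v x ∉ T).card : ℝ) ≤
        ∑ v ∈ B, Real.exp (-(Y v).card / (4 * k * k')) := by
  have hk'R : (0 : ℝ) < k' := by exact_mod_cast hk'
  obtain ⟨T, hTA, hTm, hT⟩ := exists_subset_sum_exp_le B hk
    (fun v a ↦ (((Y v).filter fun x ↦ g v x = a).card : ℝ) / (2 * k')) m A (fun _ ↦ 1)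
    (by simp) hA (by
      intro v hv a ha
      refine ⟨by positivity, ?_⟩
      rw [div_le_one (by positivity)]
      exact_mod_cast hfib v hv a ha)
  obtain ⟨S, hSC, hSm, hS⟩ := exists_subset_sum_exp_le B hk'
    (fun v x ↦ if x ∈ Y v ∧ g v x ∈ T then (1 : ℝ) else 0) m' C (fun _ ↦ 1)
    (by simp) hC (by
      intro v hv a ha
      split_ifs <;> norm_num)
  refine ⟨T, hTA, S, hSC, hTm, hSm, ?_⟩
  simp only [one_mul] at hT hS
  calc ((B.filter fun v ↦ ∀ x ∈ Y v, x ∈ S → g v x ∉ T).card : ℝ)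
      = ∑ v ∈ B.filter (fun v ↦ ∀ x ∈ Y v, x ∈ S → g v x ∉ T),
          Real.exp (-∑ x ∈ S, if x ∈ Y v ∧ g v x ∈ T then (1 : ℝ) else 0) := by
        rw [Finset.cast_card]
        refine Finset.sum_congr rfl fun v hv ↦ ?_
        rw [Finset.sum_eq_zero, neg_zero, Real.exp_zero]
        intro x hx
        rw [if_neg]
        exact fun h ↦ (Finset.mem_filter.1 hv).2 x h.1 hx h.2
    _ ≤ ∑ v ∈ B, Real.exp (-∑ x ∈ S, if x ∈ Y v ∧ g v x ∈ T then (1 : ℝ) else 0) :=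
        Finset.sum_le_sum_of_subset_of_nonneg (Finset.filter_subset _ _)
          fun _ _ _ ↦ (Real.exp_pos _).le
    _ ≤ _ := hS
    _ = ∑ v ∈ B, Real.exp (-∑ a ∈ T, (((Y v).filter fun x ↦ g v x = a).card : ℝ) / (2 * k')) := by
        refine Finset.sum_congr rfl fun v hv ↦ ?_
        rw [← Finset.sum_div, neg_div]
        congr 3
        rw [← Finset.sum_filter, Finset.sum_const, nsmul_one, ← Nat.cast_sum]
        congr 1
        rw [← Finset.card_biUnion]
        · congr 1
          ext x
          simp only [Finset.mem_filter, Finset.mem_biUnion]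
          exact ⟨fun h ↦ ⟨_, h.2.2, h.2.1, rfl⟩,
            fun ⟨a, ha, hx, h⟩ ↦ ⟨hY v hv hx, hx, h ▸ ha⟩⟩
        · intro a _ b _ hab
          rw [Function.onFun, Finset.disjoint_left]
          intro x hx hx'
          exact hab ((Finset.mem_filter.1 hx).2.symm.trans (Finset.mem_filter.1 hx').2)
    _ ≤ _ := hT
    _ = _ := by
        refine Finset.sum_congr rfl fun v hv ↦ ?_
        rw [← Finset.sum_div, ← Nat.cast_sum, ← Finset.card_eq_sum_card_fiberwise (hg v hv)]
        congr 1
        field_simp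
        ring

open Classical in
/-- Few vertices have many neighbours in a small set. -/
theorem card_filter_lt_card_adj_mul_le {V : Type*} [Fintype V] (H : SimpleGraph V)
    (D : Finset V) {d s : ℝ}
    (hdeg : ∀ v, ((Finset.univ.filter fun u ↦ H.Adj v u).card : ℝ) ≤ d) :
    ((Finset.univ.filter fun v ↦ s < ((D.filter fun u ↦ H.Adj v u).card : ℝ)).card : ℝ) * s ≤
      D.card * d := by
  set L := Finset.univ.filter fun v ↦ s < ((D.filter fun u ↦ H.Adj v u).card : ℝ)
  calc (L.card : ℝ) * s = ∑ v ∈ L, s := by simp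
    _ ≤ ∑ v ∈ L, ((D.filter fun u ↦ H.Adj v u).card : ℝ) :=
        Finset.sum_le_sum fun v hv ↦ (Finset.mem_filter.1 hv).2.le
    _ ≤ ∑ v, ((D.filter fun u ↦ H.Adj v u).card : ℝ) :=
        Finset.sum_le_sum_of_subset_of_nonneg (Finset.subset_univ _) fun _ _ _ ↦ by positivity
    _ = ∑ u ∈ D, ((Finset.univ.filter fun v ↦ H.Adj v u).card : ℝ) := by
        exact_mod_cast Finset.sum_card_bipartiteAbove_eq_sum_card_bipartiteBelow
          (s := Finset.univ) (t := D) (fun v u ↦ H.Adj v u)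
    _ ≤ ∑ u ∈ D, d := Finset.sum_le_sum fun u _ ↦ by
        simpa only [H.adj_comm] using hdeg u
    _ = _ := by rw [Finset.sum_const, nsmul_eq_mul]

theorem ncard_cnbhd_le {V : Type*} [Fintype V] (H : SimpleGraph V) (S : Finset V) {d : ℝ}
    (hdeg : ∀ v, ((H.neighborSet v).ncard : ℝ) ≤ d) :
    ((cnbhd H (S : Set V)).ncard : ℝ) ≤ S.card * (1 + d) := by
  classical
  have hsub : cnbhd H (S : Set V) ⊆ ↑(S.biUnion fun v ↦ insert v (H.neighborFinset v)) := by
    rintro x (hx | ⟨-, u, hu, h⟩)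
    · exact Finset.mem_coe.2 (Finset.mem_biUnion.2 ⟨x, hx, by simp⟩)
    · exact Finset.mem_coe.2 (Finset.mem_biUnion.2 ⟨u, hu, by simp [h]⟩)
  calc ((cnbhd H (S : Set V)).ncard : ℝ)
      ≤ ((S.biUnion fun v ↦ insert v (H.neighborFinset v)).card : ℝ) := by
        rw [← Set.ncard_coe_finset]
        exact_mod_cast Set.ncard_le_ncard hsub (Set.toFinite _)
    _ ≤ ∑ v ∈ S, ((insert v (H.neighborFinset v)).card : ℝ) := by
        exact_mod_cast Finset.card_biUnion_le
    _ ≤ ∑ v ∈ S, (1 + d) := by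
        refine Finset.sum_le_sum fun v _ ↦ ?_
        have h1 : ((insert v (H.neighborFinset v)).card : ℝ) ≤ (H.neighborFinset v).card + 1 := by
          exact_mod_cast Finset.card_insert_le _ _
        have h2 := hdeg v
        rw [← H.coe_neighborFinset v, Set.ncard_coe_finset] at h2
        linarith
    _ = _ := by rw [Finset.sum_const, nsmul_eq_mul]

open Classical in
/-- Vertices at distance two from `v` that are reached through common neighbours of `v` and `a`
lie in the neighbourhood of the set of these common neighbours. -/
theorem card_le_of_subset_nbhd_inter {V : Type*} [Fintype V] (H : SimpleGraph V) {v a : V}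
    (X : Finset V) (p : V → V) (hX : ∀ x ∈ X, H.dist v x = 2 ∧ H.Adj v (p x) ∧ H.Adj (p x) x ∧
      H.Adj a (p x)) :
    X.card ≤ (nbhd H (H.neighborSet v ∩ H.neighborSet a)).ncard := by
  rw [← Set.ncard_coe_finset]
  refine Set.ncard_le_ncard (fun x hx ↦ ?_) (Set.toFinite _)
  obtain ⟨h2, hv, hpx, ha⟩ := hX x hx
  refine ⟨fun h ↦ ?_, p x, ⟨hv, ha⟩, hpx⟩
  have := SimpleGraph.dist_eq_one_iff_adj.2 h.1
  omega

open Classical in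
/-- If the second neighbours of `v` reached through `D` are few, and the bad ones are many, then a
single pair of distinct colours occurs on many of the remaining bad ones. -/
theorem exists_colour_pair {V : Type*} [Fintype V] (H : SimpleGraph V) {d s b : ℝ} {v : V}
    (p : V → V) (hp : ∀ x, H.dist v x = 2 → H.Adj v (p x) ∧ H.Adj x (p x))
    (D : Finset V) (f : V → V) (φ : V → Fin 3) (hd : 0 ≤ d)
    (hdeg : ∀ v, ((Finset.univ.filter fun u ↦ H.Adj v u).card : ℝ) ≤ d)
    (hD : ((D.filter fun u ↦ H.Adj v u).card : ℝ) ≤ s)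
    (hbad : b ≤ ((Finset.univ.filter fun x ↦ H.dist v x = 2 ∧
      (p x ∈ D ∨ φ (f (p x)) ≠ φ x)).card : ℝ)) :
    ∃ ij ∈ (Finset.univ : Finset (Fin 3)).offDiag, (b - s * d) / 6 ≤
      ((Finset.univ.filter fun x ↦ H.dist v x = 2 ∧ p x ∉ D ∧
        φ (f (p x)) = ij.1 ∧ φ x = ij.2).card : ℝ) := by
  set X := Finset.univ.filter fun x ↦ H.dist v x = 2 ∧ p x ∈ D
  set Z := Finset.univ.filter fun x ↦ H.dist v x = 2 ∧ p x ∉ D ∧ φ (f (p x)) ≠ φ x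
  have hX : (X.card : ℝ) ≤ s * d := by
    have hsub : X ⊆ (D.filter fun u ↦ H.Adj v u).biUnion
        fun u ↦ Finset.univ.filter fun x ↦ H.Adj u x := by
      intro x hx
      obtain ⟨-, h2, hxD⟩ := Finset.mem_filter.1 hx
      have := hp x h2
      exact Finset.mem_biUnion.2 ⟨p x, Finset.mem_filter.2 ⟨hxD, this.1⟩, by simp [this.2.symm]⟩
    calc (X.card : ℝ) ≤ ∑ u ∈ D.filter fun u ↦ H.Adj v u,
          ((Finset.univ.filter fun x ↦ H.Adj u x).card : ℝ) := by
            exact_mod_cast (Finset.card_le_card hsub).trans Finset.card_biUnion_le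
      _ ≤ ∑ u ∈ D.filter fun u ↦ H.Adj v u, d := Finset.sum_le_sum fun u _ ↦ hdeg u
      _ = ((D.filter fun u ↦ H.Adj v u).card : ℝ) * d := by simp
      _ ≤ s * d := by gcongr
  have hXZ : b ≤ (X.card : ℝ) + Z.card := by
    refine hbad.trans ?_
    have hsub : (Finset.univ.filter fun x ↦ H.dist v x = 2 ∧
        (p x ∈ D ∨ φ (f (p x)) ≠ φ x)) ⊆ X ∪ Z := by
      intro x hx
      simp only [X, Z, Finset.mem_union, Finset.mem_filter, Finset.mem_univ, true_and] at hx ⊢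
      tauto
    exact_mod_cast (Finset.card_le_card hsub).trans (Finset.card_union_le _ _)
  have hcard : (Finset.univ : Finset (Fin 3)).offDiag.card = 6 := by decide
  obtain ⟨ij, hij, h⟩ := Finset.exists_le_card_fiber_of_nsmul_le_card_of_maps_to
    (s := Z) (t := (Finset.univ : Finset (Fin 3)).offDiag) (f := fun x ↦ (φ (f (p x)), φ x))
    (b := (b - s * d) / 6)
    (fun x hx ↦ by
      simpa [Finset.mem_offDiag] using (Finset.mem_filter.1 hx).2.2.2)
    (Finset.card_pos.1 (by rw [hcard]; norm_num))
    (by rw [hcard, nsmul_eq_mul]; push_cast; linarith)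
  refine ⟨ij, hij, h.trans ?_⟩
  refine Nat.cast_le.2 (Finset.card_le_card fun x hx ↦ ?_)
  simp only [Z, Finset.mem_filter, Finset.mem_univ, true_and, Prod.ext_iff] at hx ⊢
  tauto

open Classical in
/-- All but few vertices are not at distance two from `r` and have few neighbours outside the
third neighbourhood of `r`. -/
theorem le_card_typical {V : Type*} [Fintype V] (H : SimpleGraph V) (r : V) {q e : ℝ}
    (he : 1 ≤ e) (heq : e ≤ q) (hcard : (Fintype.card V : ℝ) = q ^ 3)
    (hdeg : ∀ v, ((Finset.univ.filter fun u ↦ H.Adj v u).card : ℝ) ≤ q * e)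
    (h2 : ((Finset.univ.filter fun u ↦ H.dist r u = 2).card : ℝ) ≤ q ^ 2 * e ^ 2)
    (h3 : q ^ 3 - 4 * (q ^ 2 * e ^ 2) ≤
      ((Finset.univ.filter fun u ↦ 1 ≤ H.dist r u ∧ H.dist r u ≤ 3).card : ℝ)) :
    q ^ 3 - 7 * (q ^ 2 * e ^ 5) ≤ ((Finset.univ.filter fun v ↦ H.dist r v ≠ 2 ∧
      (((Finset.univ.filter fun u ↦ H.dist r u ≠ 3).filter fun u ↦ H.Adj v u).card : ℝ) ≤
        q / e ^ 2).card : ℝ) := by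
  have he0 : 0 < e := by linarith
  have hq0 : 0 < q := by linarith
  set D := Finset.univ.filter fun u ↦ H.dist r u ≠ 3
  have hD : (D.card : ℝ) ≤ 6 * (q ^ 2 * e ^ 2) := by
    have hsub : D ⊆ (Finset.univ.filter fun u ↦ ¬(1 ≤ H.dist r u ∧ H.dist r u ≤ 3)) ∪
        ((Finset.univ.filter fun u ↦ H.Adj r u) ∪
          Finset.univ.filter fun u ↦ H.dist r u = 2) := by
      intro u hu
      simp only [D, Finset.mem_union, Finset.mem_filter, Finset.mem_univ, true_and,
        ← SimpleGraph.dist_eq_one_iff_adj] at hu ⊢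
      omega
    have h := (Finset.card_le_card hsub).trans ((Finset.card_union_le _ _).trans
      (Nat.add_le_add_left (Finset.card_union_le _ _) _))
    have hsum := Finset.card_filter_add_card_filter_not (s := (Finset.univ : Finset V))
      fun u ↦ 1 ≤ H.dist r u ∧ H.dist r u ≤ 3
    rw [Finset.card_univ] at hsum
    have hR : (D.card : ℝ) ≤ _ := Nat.cast_le.2 h
    have hsumR := congrArg (Nat.cast : ℕ → ℝ) hsum
    push_cast at hR hsumR
    have := hdeg r
    have : q * e ≤ q ^ 2 * e ^ 2 := by
      have : 1 ≤ q * e := by nlinarith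
      nlinarith
    linarith
  have hL := card_filter_lt_card_adj_mul_le H D (s := q / e ^ 2) hdeg
  set L := Finset.univ.filter fun v ↦ q / e ^ 2 < ((D.filter fun u ↦ H.Adj v u).card : ℝ)
  have hL' : (L.card : ℝ) ≤ 6 * (q ^ 2 * e ^ 5) := by
    have : (L.card : ℝ) * (q / e ^ 2) ≤ 6 * (q ^ 2 * e ^ 5) * (q / e ^ 2) := by
      refine hL.trans ((mul_le_mul_of_nonneg_right hD (by positivity)).trans (le_of_eq ?_))
      field_simp
    exact le_of_mul_le_mul_right this (by positivity)
  have hsub : (Finset.univ : Finset V) ⊆ (Finset.univ.filter fun v ↦ H.dist r v ≠ 2 ∧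
      ((D.filter fun u ↦ H.Adj v u).card : ℝ) ≤ q / e ^ 2) ∪
      (L ∪ Finset.univ.filter fun u ↦ H.dist r u = 2) := by
    intro v _
    simp only [L, Finset.mem_union, Finset.mem_filter, Finset.mem_univ, true_and, ← not_le]
    tauto
  have h := (Finset.card_le_card hsub).trans ((Finset.card_union_le _ _).trans
      (Nat.add_le_add_left (Finset.card_union_le _ _) _))
  rw [Finset.card_univ] at h
  have hR : (Fintype.card V : ℝ) ≤ _ := Nat.cast_le.2 h
  push_cast at hR
  have : q ^ 2 * e ^ 2 ≤ q ^ 2 * e ^ 5 := by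
    gcongr
    norm_num
  linarith

theorem exists_nat_ge_le_two_mul {y : ℝ} (hy : 1 ≤ y) : ∃ n : ℕ, 0 < n ∧ y ≤ n ∧ (n : ℝ) ≤ 2 * y :=
  ⟨⌈y⌉₊, Nat.ceil_pos.2 (by linarith), Nat.le_ceil y,
    by linarith [Nat.ceil_lt_add_one (show 0 ≤ y by linarith)]⟩

open Classical in
/-- The structural lemma with `q` playing the role of `μ ^ (1 / 3)` and `e` that of `μ ^ ε`. -/
theorem exists_sets_of_many_bad {V : Type*} [Fintype V] (H : SimpleGraph V) (r : V) {q e : ℝ}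
    (he : 2300 ≤ e) (heq : e ^ 11 ≤ q) (hcard : (Fintype.card V : ℝ) = q ^ 3)
    (hdeg : ∀ v, ((H.neighborSet v).ncard : ℝ) ≤ q * e)
    (h2 : ((Finset.univ.filter fun u ↦ H.dist r u = 2).card : ℝ) ≤ q ^ 2 * e ^ 2)
    (h3 : q ^ 3 - 4 * (q ^ 2 * e ^ 2) ≤
      ((Finset.univ.filter fun u ↦ 1 ≤ H.dist r u ∧ H.dist r u ≤ 3).card : ℝ))
    (hco : ∀ u v : V, u ≠ v →
      ((nbhd H (H.neighborSet u ∩ H.neighborSet v)).ncard : ℝ) ≤ q * e)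
    (n : V → V) (hn : ∀ a, H.dist r a = 3 → H.Adj a (n a) ∧ H.dist r (n a) = 2)
    (p : V → V → V) (hp : ∀ v x, H.dist v x = 2 → H.Adj v (p v x) ∧ H.Adj x (p v x))
    (φ : V → Fin 3)
    (hbad : ∀ v, 3 * (q ^ 2 / e) ≤ ((Finset.univ.filter fun x ↦ H.dist v x = 2 ∧
      (H.dist r (p v x) ≠ 3 ∨ φ (n (p v x)) ≠ φ x)).card : ℝ)) :
    ∃ T S : Finset V, (T.card : ℝ) ≤ 2 * (q ^ 2 / e) ∧ (S.card : ℝ) ≤ 2 * (q ^ 2 / e) ∧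
      ∃ i j : Fin 3, i ≠ j ∧ (∀ t ∈ T, φ t = i) ∧ (∀ t ∈ S, φ t = j) ∧
        q ^ 3 / 7 ≤ ((nbhd H (cnbhd H (T : Set V) ∩ cnbhd H (S : Set V))).ncard : ℝ) := by
  have he1 : 1 ≤ e := by linarith
  have he0 : 0 < e := by linarith
  have hle : e ≤ q := (le_self_pow₀ he1 (by norm_num)).trans heq
  have hq1 : 1 ≤ q := he1.trans hle
  have hq0 : 0 < q := by linarith
  have hdeg' : ∀ v, ((Finset.univ.filter fun u ↦ H.Adj v u).card : ℝ) ≤ q * e := by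
    intro v
    refine le_trans (le_of_eq ?_) (hdeg v)
    rw [← Set.ncard_coe_finset]
    congr 2
    ext u; simp
  have hBcard := le_card_typical H r he1 hle hcard hdeg' h2 h3
  set D := Finset.univ.filter fun u ↦ H.dist r u ≠ 3
  set B := Finset.univ.filter fun v ↦ H.dist r v ≠ 2 ∧
    ((D.filter fun u ↦ H.Adj v u).card : ℝ) ≤ q / e ^ 2
  have hmemD : ∀ u, u ∈ D ↔ H.dist r u ≠ 3 := by simp [D]
  have hpair : ∀ v ∈ B, ∃ ij ∈ (Finset.univ : Finset (Fin 3)).offDiag, q ^ 2 / (3 * e) ≤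
      ((Finset.univ.filter fun x ↦ H.dist v x = 2 ∧ p v x ∉ D ∧
        φ (n (p v x)) = ij.1 ∧ φ x = ij.2).card : ℝ) := by
    intro v hv
    obtain ⟨ij, hij, h⟩ := exists_colour_pair H (b := 3 * (q ^ 2 / e)) (p v) (hp v) D n φ
      (by positivity) hdeg' (Finset.mem_filter.1 hv).2.2 (by simpa only [hmemD] using hbad v)
    refine ⟨ij, hij, le_trans (le_of_eq ?_) h⟩
    field_simp
    norm_num
  choose! ij hij hijY using hpair
  have hcard6 : (Finset.univ : Finset (Fin 3)).offDiag.card = 6 := by decide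
  obtain ⟨⟨i, j⟩, hmem, hBij⟩ := Finset.exists_le_card_fiber_of_nsmul_le_card_of_maps_to
    (s := B) (f := ij) (b := (B.card : ℝ) / 6) hij
    (Finset.card_pos.1 (by rw [hcard6]; norm_num))
    (by rw [hcard6, nsmul_eq_mul]; push_cast; linarith)
  set B' := B.filter fun v ↦ ij v = (i, j)
  let A := Finset.univ.filter fun a ↦ H.dist r a = 2 ∧ φ a = i
  let C := Finset.univ.filter fun x ↦ φ x = j
  let Y : V → Finset V := fun v ↦ Finset.univ.filter fun x ↦ H.dist v x = 2 ∧ p v x ∉ D ∧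
    φ (n (p v x)) = i ∧ φ x = j
  have hYcard : ∀ v ∈ B', q ^ 2 / (3 * e) ≤ ((Y v).card : ℝ) := by
    intro v hv
    obtain ⟨hvB, hvij⟩ := Finset.mem_filter.1 hv
    have := hijY v hvB
    simpa only [hvij] using this
  have hY : ∀ v x, x ∈ Y v ↔ H.dist v x = 2 ∧ H.dist r (p v x) = 3 ∧
      φ (n (p v x)) = i ∧ φ x = j := by
    intro v x
    simp [Y, D]
  obtain ⟨k, hk0, hk, hk2⟩ := exists_nat_ge_le_two_mul (y := e ^ 3) (one_le_pow₀ he1)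
  obtain ⟨k', hk'0, hk', hk'2⟩ := exists_nat_ge_le_two_mul (y := q * e ^ 2)
    (one_le_mul_of_one_le_of_one_le hq1 (one_le_pow₀ he1))
  have he2q : e ^ 2 ≤ q := (pow_le_pow_right₀ he1 (by norm_num)).trans heq
  obtain ⟨m, -, hm, hm2⟩ := exists_nat_ge_le_two_mul (y := q ^ 2 / e)
    (by rw [le_div_iff₀ he0]; nlinarith)
  obtain ⟨m', -, hm', hm'2⟩ := exists_nat_ge_le_two_mul (y := q ^ 2 / e ^ 2)
    (by rw [le_div_iff₀ (by positivity)]; nlinarith)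
  have hA : A.card ≤ m * k := by
    have : (A.card : ℝ) ≤ m * k := by
      calc (A.card : ℝ) ≤ ((Finset.univ.filter fun u ↦ H.dist r u = 2).card : ℝ) :=
            Nat.cast_le.2 (Finset.card_le_card fun x hx ↦ by simp_all [A])
        _ ≤ q ^ 2 * e ^ 2 := h2
        _ = q ^ 2 / e * e ^ 3 := by field_simp
        _ ≤ m * k := by gcongr
    exact_mod_cast this
  have hC : C.card ≤ m' * k' := by
    have : (C.card : ℝ) ≤ m' * k' := by
      calc (C.card : ℝ) ≤ Fintype.card V := Nat.cast_le.2 (Finset.card_le_univ _)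
        _ = q ^ 2 / e ^ 2 * (q * e ^ 2) := by rw [hcard]; field_simp
        _ ≤ m' * k' := by gcongr
    exact_mod_cast this
  obtain ⟨T, hTA, S, hSC, hTm, hSm, hmiss⟩ := exists_subsets_card_not_hit_le B' A C hk0 hk'0 hA hC
    Y (fun v x ↦ n (p v x))
    (fun v _ x hx ↦ by simpa [C] using ((hY v x).1 hx).2.2.2)
    (fun v _ x hx ↦ by
      obtain ⟨-, h3, hi, -⟩ := (hY v x).1 hx
      simpa [A] using ⟨(hn _ h3).2, hi⟩)
    (by
      intro v hv a ha
      have hva : v ≠ a := by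
        rintro rfl
        exact (Finset.mem_filter.1 (Finset.mem_filter.1 hv).1).2.1 (Finset.mem_filter.1 ha).2.1
      have h1 := card_le_of_subset_nbhd_inter H (v := v) (a := a)
        ((Y v).filter fun x ↦ n (p v x) = a) (p v) (by
          intro x hx
          obtain ⟨hxY, rfl⟩ := Finset.mem_filter.1 hx
          obtain ⟨h2, h3, -⟩ := (hY v x).1 hxY
          exact ⟨h2, (hp v x h2).1, (hp v x h2).2.symm, (hn _ h3).1.symm⟩)
      have h4 : (((Y v).filter fun x ↦ n (p v x) = a).card : ℝ) ≤ 2 * k' := by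
        refine (Nat.cast_le.2 h1).trans ((hco v a hva).trans ?_)
        nlinarith [mul_pos hq0 he0]
      exact_mod_cast h4)
  have hi : ∀ t ∈ T, φ t = i := fun t ht ↦ (Finset.mem_filter.1 (hTA ht)).2.2
  have hj : ∀ t ∈ S, φ t = j := fun t ht ↦ (Finset.mem_filter.1 (hSC ht)).2
  have hTmR : (T.card : ℝ) ≤ m := by exact_mod_cast hTm
  have hSmR : (S.card : ℝ) ≤ m' := by exact_mod_cast hSm
  have hm'e : q ^ 2 / e ^ 2 ≤ q ^ 2 / e := by
    gcongr
    exact le_self_pow₀ he1 (by norm_num)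
  refine ⟨T, S, by linarith, by linarith, i, j, by simpa using hmem, hi, hj, ?_⟩
  set M := B'.filter fun v ↦ ∀ x ∈ Y v, x ∈ S → n (p v x) ∉ T
  set W := cnbhd H (T : Set V) ∩ cnbhd H (S : Set V)
  have hcover : (B' : Set V) ⊆ nbhd H W ∪ (↑M ∪ cnbhd H (S : Set V)) := by
    intro v hv
    by_cases hvM : v ∈ M
    · exact Or.inr (Or.inl hvM)
    by_cases hvS : v ∈ cnbhd H (S : Set V)
    · exact Or.inr (Or.inr hvS)
    obtain ⟨x, hx, hxS, hxT⟩ : ∃ x ∈ Y v, x ∈ S ∧ n (p v x) ∈ T := by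
      by_contra! hcon
      exact hvM (Finset.mem_filter.2 ⟨hv, hcon⟩)
    obtain ⟨hd2, hd3, -⟩ := (hY v x).1 hx
    have hnbr : ∀ (U : Set V) (u), u ∈ U → H.Adj u (p v x) → p v x ∈ cnbhd H U := by
      intro U u hu hadj
      by_cases hpU : p v x ∈ U
      · exact Or.inl hpU
      · exact Or.inr ⟨hpU, u, hu, hadj⟩
    exact Or.inl ⟨fun h ↦ hvS h.2, p v x,
      ⟨hnbr _ _ hxT (hn _ hd3).1.symm, hnbr _ _ hxS (hp v x hd2).2⟩, (hp v x hd2).1.symm⟩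
  have hcount : (B'.card : ℝ) ≤
      (nbhd H W).ncard + (M.card + (cnbhd H (S : Set V)).ncard) := by
    have h := (Set.ncard_le_ncard hcover (Set.toFinite _)).trans ((Set.ncard_union_le _ _).trans
      (Nat.add_le_add_left (Set.ncard_union_le _ _) _))
    rw [Set.ncard_coe_finset, Set.ncard_coe_finset] at h
    exact_mod_cast h
  have hM : (M.card : ℝ) ≤ 48 * (q ^ 2 * e ^ 6) := by
    have hmiss' : (M.card : ℝ) ≤ ∑ v ∈ B', Real.exp (-(Y v).card / (4 * k * k')) := by
      convert hmiss
    refine hmiss'.trans ?_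
    have hterm : ∀ v ∈ B', Real.exp (-(Y v).card / (4 * k * k')) ≤ 48 * e ^ 6 / q := by
      intro v hv
      have hy : q / (48 * e ^ 6) ≤ (Y v).card / (4 * k * k') := by
        rw [le_div_iff₀ (by positivity)]
        refine le_trans ?_ (hYcard v hv)
        calc q / (48 * e ^ 6) * (4 * k * k')
            ≤ q / (48 * e ^ 6) * (4 * (2 * e ^ 3) * (2 * (q * e ^ 2))) := by gcongr
          _ = _ := by field_simp; norm_num
      calc Real.exp (-(Y v).card / (4 * k * k')) ≤ Real.exp (-(q / (48 * e ^ 6))) := by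
            rw [neg_div]; gcongr
        _ ≤ (q / (48 * e ^ 6))⁻¹ := by
            rw [Real.exp_neg]
            gcongr
            linarith [Real.add_one_le_exp (q / (48 * e ^ 6))]
        _ = _ := by rw [inv_div]
    calc ∑ v ∈ B', Real.exp (-(Y v).card / (4 * k * k'))
        ≤ ∑ v ∈ B', 48 * e ^ 6 / q := Finset.sum_le_sum hterm
      _ = B'.card * (48 * e ^ 6 / q) := by rw [Finset.sum_const, nsmul_eq_mul]
      _ ≤ q ^ 3 * (48 * e ^ 6 / q) := by
          gcongr
          rw [← hcard]
          exact Nat.cast_le.2 (Finset.card_le_univ _)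
      _ = _ := by field_simp
  have hS : ((cnbhd H (S : Set V)).ncard : ℝ) ≤ 4 * (q ^ 3 / e) := by
    calc ((cnbhd H (S : Set V)).ncard : ℝ) ≤ S.card * (1 + q * e) := ncard_cnbhd_le H S hdeg
      _ ≤ (2 * (q ^ 2 / e ^ 2)) * (q * e + q * e) := by
          gcongr
          · linarith
          · nlinarith
      _ = _ := by field_simp; norm_num
  have h6 : q ^ 2 * e ^ 6 ≤ q ^ 3 / e := by
    rw [le_div_iff₀ he0]
    calc q ^ 2 * e ^ 6 * e = q ^ 2 * e ^ 7 := by ring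
      _ ≤ q ^ 2 * q := by
          gcongr
          exact (pow_le_pow_right₀ he1 (by norm_num)).trans heq
      _ = q ^ 3 := by ring
  have h5 : q ^ 2 * e ^ 5 ≤ q ^ 2 * e ^ 6 := by
    gcongr
    norm_num
  have hfin : q ^ 3 / e ≤ q ^ 3 / 2300 := by gcongr
  have hq3 : 0 < q ^ 3 := by positivity
  linarith

/-- the main structural lemma. For every proper 3-colouring of a graph `H`
satisfying the degree/expansion conditions, either outcome (a) (two small disjoint
monochromatic sets of distinct colours whose common closed neighbourhood has large
neighbourhood) or outcome (b) (a vertex `v` with few "bad" second neighbours) holds. -/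
theorem stmt_2 (ε : ℝ) (hε0 : 0 < ε) (hε : ε < 1/33) :
    ∃ ℓ : ℝ, 0 < ℓ ∧
    ∀ (μ : ℕ) (V : Type) [Fintype V] (H : SimpleGraph V),
      ℓ ≤ (μ : ℝ) → Fintype.card V = μ →
      (∀ v : V, ((H.neighborSet v).ncard : ℝ) ≤ (μ : ℝ) ^ ((1:ℝ)/3 + ε)) →
      (∀ v : V, (({u : V | H.dist v u = 2}).ncard : ℝ) ≤ (μ : ℝ) ^ ((2:ℝ)/3 + 2*ε)) →
      (∀ v : V, (μ : ℝ) - 4 * (μ : ℝ) ^ ((2:ℝ)/3 + 2*ε) ≤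
        (({u : V | 1 ≤ H.dist v u ∧ H.dist v u ≤ 3}).ncard : ℝ)) →
      (∀ u v : V, u ≠ v →
        ((nbhd H (H.neighborSet u ∩ H.neighborSet v)).ncard : ℝ) ≤ (μ : ℝ) ^ ((1:ℝ)/3 + ε)) →
      ∀ r : V, ∀ nr : V → V,
        (∀ a : V, H.dist r a = 3 → nr a ∈ H.neighborSet a ∧ H.dist r (nr a) = 2) →
      ∀ p : V → V → V,
        (∀ v x : V, H.dist v x = 2 → p v x ∈ H.neighborSet v ∩ H.neighborSet x) →
      ∀ φ : V → Fin 3, (∀ a b : V, H.Adj a b → φ a ≠ φ b) →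
      ((∃ T Tt : Set V, Disjoint T Tt ∧
          (T.ncard : ℝ) ≤ 2 * (μ : ℝ) ^ ((2:ℝ)/3 - ε) ∧
          (Tt.ncard : ℝ) ≤ 2 * (μ : ℝ) ^ ((2:ℝ)/3 - ε) ∧
          ∃ i j : Fin 3, i ≠ j ∧ (∀ t ∈ T, φ t = i) ∧ (∀ t ∈ Tt, φ t = j) ∧
            (μ : ℝ) / 7 ≤ ((nbhd H (cnbhd H T ∩ cnbhd H Tt)).ncard : ℝ))
        ∨
       (∃ v : V,
          (({x : V | H.dist v x = 2 ∧
              (H.dist r (p v x) ≠ 3 ∨ φ (nr (p v x)) ≠ φ x)}).ncard : ℝ)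
            ≤ 3 * (μ : ℝ) ^ ((2:ℝ)/3 - ε))) := by
  classical
  refine ⟨(2300 : ℝ) ^ (1 / ε), by positivity, ?_⟩
  intro μ V _ H hμ hcard hdeg h2 h3 hco r nr hnr p hp φ _
  have hμ1 : (1 : ℝ) ≤ μ :=
    (Real.one_le_rpow (by norm_num) (by positivity)).trans hμ
  have hμ0 : (0 : ℝ) < μ := by linarith
  set q : ℝ := (μ : ℝ) ^ ((1 : ℝ) / 3) with hq
  set e : ℝ := (μ : ℝ) ^ ε with he
  have hq0 : 0 < q := Real.rpow_pos_of_pos hμ0 _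
  have he0 : 0 < e := Real.rpow_pos_of_pos hμ0 _
  have he2300 : 2300 ≤ e := by
    calc (2300 : ℝ) = ((2300 : ℝ) ^ (1 / ε)) ^ ε := by
          rw [← Real.rpow_mul (by norm_num), one_div_mul_cancel hε0.ne', Real.rpow_one]
      _ ≤ e := Real.rpow_le_rpow (by positivity) hμ hε0.le
  have hqpow : ∀ n : ℕ, q ^ n = (μ : ℝ) ^ ((n : ℝ) / 3) := by
    intro n
    rw [hq, ← Real.rpow_natCast, ← Real.rpow_mul hμ0.le]
    congr 1; ring
  have hepow : ∀ n : ℕ, e ^ n = (μ : ℝ) ^ (n * ε) := by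
    intro n
    rw [he, ← Real.rpow_natCast, ← Real.rpow_mul hμ0.le, mul_comm]
  have heq : e ^ 11 ≤ q := by
    rw [hepow, hq]
    exact Real.rpow_le_rpow_of_exponent_le hμ1 (by push_cast; linarith)
  have e1 : (μ : ℝ) ^ ((1 : ℝ) / 3 + ε) = q * e := Real.rpow_add hμ0 _ _
  have e2 : (μ : ℝ) ^ ((2 : ℝ) / 3 + 2 * ε) = q ^ 2 * e ^ 2 := by
    rw [hqpow, hepow, Real.rpow_add hμ0]; norm_num
  have e3 : (μ : ℝ) ^ ((2 : ℝ) / 3 - ε) = q ^ 2 / e := by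
    rw [hqpow, Real.rpow_sub hμ0, ← he]; norm_num
  have e4 : (μ : ℝ) = q ^ 3 := by
    rw [hqpow]; norm_num
  have hncard : ∀ (P : V → Prop) [DecidablePred P],
      ({x : V | P x}).ncard = (Finset.univ.filter P).card := by
    intro P _
    rw [← Set.ncard_coe_finset]
    congr 1
    ext; simp
  rw [e3]
  simp only [e1, e2] at hdeg h2 h3 hco
  refine or_iff_not_imp_right.2 fun hb ↦ ?_
  push Not at hb
  obtain ⟨T, S, hT, hS, i, j, hij, hi, hj, h⟩ := exists_sets_of_many_bad H r he2300 heq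
    (by rw [hcard, e4]) hdeg (by rw [← hncard]; exact h2 r)
    (by rw [← hncard, ← e4]; exact h3 r) hco nr hnr p hp φ
    (fun v ↦ by rw [← hncard]; exact (hb v).le)
  refine ⟨T, S, ?_, by rwa [Set.ncard_coe_finset], by rwa [Set.ncard_coe_finset], i, j, hij,
    fun t ht ↦ hi t ht, fun t ht ↦ hj t ht, e4 ▸ h⟩
  exact Set.disjoint_left.2 fun t ht ht' ↦ hij ((hi t ht).symm.trans (hj t ht'))
end

section
/- Let ε ∈ (0, 1/33). There exists ℓ > 0 such that the following holds for all μ ≥ ℓ. Let H be a finite simple graph on μ vertices such that for each vertex v ∈ V(H): |N(v)| ≤ μ^{1/3+ε}, |N^{(2)}(v)| ≤ μ^{2/3+2ε}, and |N^{(≤3)}(v)| ≥ μ − 4μ^{2/3+2ε}. Let r ∈ V(H), let R = V(H) \ N^{(3)}(r), and let V' = {v ∈ N^{(3)}(r) : |R ∩ N(v)| ≤ μ^{1/3−2ε}}. Then |V'| ≥ μ − 7μ^{2/3+5ε}. -/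
open Set

/-- Double counting of the edges between two vertex sets. -/
lemma SimpleGraph.ncard_mul_le_ncard_mul_of_neighborSet {V : Type*} [Finite V]
    (H : SimpleGraph V) (A B : Set V) {a b : ℝ}
    (hA : ∀ v ∈ A, a ≤ ((B ∩ H.neighborSet v).ncard : ℝ))
    (hB : ∀ u ∈ B, ((H.neighborSet u).ncard : ℝ) ≤ b) :
    (A.ncard : ℝ) * a ≤ (B.ncard : ℝ) * b := by
  classical
  have := Fintype.ofFinite V
  have hAt (v : V) : (B ∩ H.neighborSet v).ncard =
      (Finset.bipartiteAbove H.Adj B.toFinset v).card := by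
    rw [← Set.ncard_coe_finset]
    congr 1
    ext u
    simp [Finset.bipartiteAbove]
  have hBt (u : V) : (Finset.bipartiteBelow H.Adj A.toFinset u).card ≤
      (H.neighborSet u).ncard := by
    rw [← Set.ncard_coe_finset]
    refine Set.ncard_le_ncard (fun v hv => ?_) (Set.toFinite _)
    simp only [Finset.bipartiteBelow, Finset.coe_filter, Set.mem_ofPred_eq] at hv
    exact hv.2.symm
  calc (A.ncard : ℝ) * a = ∑ _v ∈ A.toFinset, a := by
        simp [Set.ncard_eq_toFinset_card']
    _ ≤ ∑ v ∈ A.toFinset, ((Finset.bipartiteAbove H.Adj B.toFinset v).card : ℝ) := by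
        refine Finset.sum_le_sum fun v hv => ?_
        rw [← hAt]
        exact hA v (by simpa using hv)
    _ = ∑ u ∈ B.toFinset, ((Finset.bipartiteBelow H.Adj A.toFinset u).card : ℝ) := by
        exact_mod_cast Finset.sum_card_bipartiteAbove_eq_sum_card_bipartiteBelow H.Adj
    _ ≤ ∑ _u ∈ B.toFinset, b := by
        refine Finset.sum_le_sum fun u hu => ?_
        exact le_trans (by exact_mod_cast hBt u) (hB u (by simpa using hu))
    _ = (B.ncard : ℝ) * b := by
        simp [Set.ncard_eq_toFinset_card']

/-- The vertices at distance between `1` and `3` from `r` are split into the three spheres. -/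
lemma SimpleGraph.ncard_dist_le_three_le {V : Type*} [Finite V] (H : SimpleGraph V) (r : V) :
    {u : V | 1 ≤ H.dist r u ∧ H.dist r u ≤ 3}.ncard ≤
      (H.neighborSet r).ncard + {u : V | H.dist r u = 2}.ncard +
        {u : V | H.dist r u = 3}.ncard := by
  have hsub : {u : V | 1 ≤ H.dist r u ∧ H.dist r u ≤ 3} ⊆
      (H.neighborSet r ∪ {u : V | H.dist r u = 2}) ∪ {u : V | H.dist r u = 3} := by
    rintro u ⟨h1, h3⟩
    obtain h | h | h : H.dist r u = 1 ∨ H.dist r u = 2 ∨ H.dist r u = 3 := by omega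
    · exact .inl (.inl (SimpleGraph.dist_eq_one_iff_adj.mp h))
    · exact .inl (.inr h)
    · exact .inr h
  have h1 := Set.ncard_le_ncard hsub (Set.toFinite _)
  have h2 := Set.ncard_union_le (H.neighborSet r ∪ {u : V | H.dist r u = 2})
    {u : V | H.dist r u = 3}
  have h3 := Set.ncard_union_le (H.neighborSet r) {u : V | H.dist r u = 2}
  omega

/-- in a graph satisfying the degree/expansion conditions, the set `V'` of
vertices at distance exactly 3 from `r` with few neighbours outside `N^{(3)}(r)`
has size at least `μ - 7μ^{2/3+5ε}`. -/
theorem stmt_3 (ε : ℝ) (hε0 : 0 < ε) (hε : ε < 1/33) :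
    ∃ ℓ : ℝ, 0 < ℓ ∧
    ∀ (μ : ℕ) (V : Type) [Fintype V] (H : SimpleGraph V),
      ℓ ≤ (μ : ℝ) → Fintype.card V = μ →
      (∀ v : V, ((H.neighborSet v).ncard : ℝ) ≤ (μ : ℝ) ^ ((1:ℝ)/3 + ε)) →
      (∀ v : V, (({u : V | H.dist v u = 2}).ncard : ℝ) ≤ (μ : ℝ) ^ ((2:ℝ)/3 + 2*ε)) →
      (∀ v : V, (μ : ℝ) - 4 * (μ : ℝ) ^ ((2:ℝ)/3 + 2*ε) ≤
        (({u : V | 1 ≤ H.dist v u ∧ H.dist v u ≤ 3}).ncard : ℝ)) →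
      ∀ r : V, ∀ R V' : Set V,
        R = {v : V | H.dist r v ≠ 3} →
        V' = {v : V | H.dist r v = 3 ∧
          ((R ∩ H.neighborSet v).ncard : ℝ) ≤ (μ : ℝ) ^ ((1:ℝ)/3 - 2*ε)} →
        (μ : ℝ) - 7 * (μ : ℝ) ^ ((2:ℝ)/3 + 5*ε) ≤ (V'.ncard : ℝ) := by
  refine ⟨6 ^ (1 / (3 * ε)), by positivity, ?_⟩
  intro μ V _ H hμ hcard hN1 hN2 hN3 r R V' hR hV'
  have hone : (1 : ℝ) ≤ μ :=
    le_trans (Real.one_le_rpow (by norm_num) (by positivity)) hμ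
  have hpos : (0 : ℝ) < μ := by linarith
  have hsix : (6 : ℝ) ≤ (μ : ℝ) ^ (3 * ε) := by
    have h := Real.rpow_le_rpow (by positivity) hμ (by positivity : 0 ≤ 3 * ε)
    rwa [← Real.rpow_mul (by norm_num), one_div_mul_cancel (by positivity), Real.rpow_one] at h
  have hle : (μ : ℝ) ^ ((1:ℝ)/3 + ε) ≤ (μ : ℝ) ^ ((2:ℝ)/3 + 2*ε) :=
    Real.rpow_le_rpow_of_exponent_le hone (by linarith)
  have hmul : (μ : ℝ) ^ ((2:ℝ)/3 + 5*ε) * (μ : ℝ) ^ ((1:ℝ)/3 - 2*ε) =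
      (μ : ℝ) ^ ((2:ℝ)/3 + 2*ε) * (μ : ℝ) ^ ((1:ℝ)/3 + ε) := by
    rw [← Real.rpow_add hpos, ← Real.rpow_add hpos]
    ring_nf
  have hsplit : (μ : ℝ) ^ ((2:ℝ)/3 + 5*ε) =
      (μ : ℝ) ^ ((2:ℝ)/3 + 2*ε) * (μ : ℝ) ^ (3 * ε) := by
    rw [← Real.rpow_add hpos]
    ring_nf
  have hApos : 0 < (μ : ℝ) ^ ((2:ℝ)/3 + 2*ε) := Real.rpow_pos_of_pos hpos _
  have hPpos : 0 < (μ : ℝ) ^ ((1:ℝ)/3 + ε) := Real.rpow_pos_of_pos hpos _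
  have hTpos : 0 < (μ : ℝ) ^ ((1:ℝ)/3 - 2*ε) := Real.rpow_pos_of_pos hpos _
  have hcompl : Rᶜ = {v : V | H.dist r v = 3} := by
    ext v
    simp [hR]
  have hRcard : (R.ncard : ℝ) + ({v : V | H.dist r v = 3}.ncard : ℝ) = μ := by
    rw [← hcompl, ← hcard, ← Nat.card_eq_fintype_card]
    exact_mod_cast Set.ncard_add_ncard_compl R
  have hsphere : ({u : V | 1 ≤ H.dist r u ∧ H.dist r u ≤ 3}.ncard : ℝ) ≤
      (H.neighborSet r).ncard + {u : V | H.dist r u = 2}.ncard +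
        {u : V | H.dist r u = 3}.ncard := by
    exact_mod_cast H.ncard_dist_le_three_le r
  have hRle : (R.ncard : ℝ) ≤ 6 * (μ : ℝ) ^ ((2:ℝ)/3 + 2*ε) := by
    linarith [hN1 r, hN2 r, hN3 r]
  have hV'sub : V' ⊆ {v : V | H.dist r v = 3} := by
    rw [hV']
    exact fun v hv => hv.1
  have hbad : ((({v : V | H.dist r v = 3} \ V').ncard : ℝ)) + V'.ncard =
      ({v : V | H.dist r v = 3}.ncard : ℝ) := by
    exact_mod_cast Set.ncard_sdiff_add_ncard_of_subset hV'sub (Set.toFinite _)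
  have hcount := H.ncard_mul_le_ncard_mul_of_neighborSet ({v : V | H.dist r v = 3} \ V') R
    (a := (μ : ℝ) ^ ((1:ℝ)/3 - 2*ε)) (fun v hv => by
      by_contra! hlt
      exact hv.2 (by rw [hV']; exact ⟨hv.1, hlt.le⟩)) (fun u _ => hN1 u)
  have hbadle : (({v : V | H.dist r v = 3} \ V').ncard : ℝ) ≤
      6 * (μ : ℝ) ^ ((2:ℝ)/3 + 5*ε) := by
    refine le_of_mul_le_mul_right ?_ hTpos
    have := mul_le_mul_of_nonneg_right hRle hPpos.le
    linarith
  have hRle' : (R.ncard : ℝ) ≤ (μ : ℝ) ^ ((2:ℝ)/3 + 5*ε) := by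
    have := mul_le_mul_of_nonneg_left hsix hApos.le
    linarith
  linarith
end

section
/- Let ε > 0 and μ ≥ 1 be real, and let H be a finite simple graph in which every vertex has degree at most μ^{1/3+ε}. Let φ : V(H) → {1,2,3} be a proper 3-colouring of H, let r ∈ V(H), let n_r : N^{(3)}(r) → V(H) be a function with n_r(a) ∈ N(a) for all a, let v ∈ V(H) with |N(v) \ N^{(3)}(r)| ≤ μ^{1/3−2ε}, and let p_v : N^{(2)}(v) → V(H) be a function with p_v(x) ∈ N(v) ∩ N(x) for all x ∈ N^{(2)}(v). Call x ∈ N^{(2)}(v) v-deducing if p_v(x) ∈ N^{(3)}(r) and φ(x) ≠ φ(n_r(p_v(x))); for a ∈ N(v) let the bucket B_a := {x ∈ N^{(2)}(v) : p_v(x) = a}, and call a v-fruitful if B_a contains at least μ^{1/3−2ε} v-deducing vertices. If at most μ^{1/3−2ε} vertices a ∈ N(v) are v-fruitful, then |{x ∈ N^{(2)}(v) : p_v(x) ∉ N^{(3)}(r) or φ(n_r(p_v(x))) ≠ φ(x)}| ≤ 3μ^{2/3−ε}. -/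
open Set

/-- A set mapped into a set of size at most `a`, with all fibres of size at most `b`, has size at
most `a * b`. -/
lemma ncard_le_mul_of_fiber_le {α β : Type*} [Finite α] [Finite β] (S : Set α) (A : Set β)
    (f : α → β) (hf : MapsTo f S A) {a b : ℝ} (hb : 0 ≤ b) (hA : (A.ncard : ℝ) ≤ a)
    (hfiber : ∀ y ∈ A, (({x : α | x ∈ S ∧ f x = y}).ncard : ℝ) ≤ b) :
    (S.ncard : ℝ) ≤ a * b := by
  classical
  have := Fintype.ofFinite α
  have := Fintype.ofFinite β
  have hcard : S.ncard = ∑ y ∈ A.toFinset, ({x : α | x ∈ S ∧ f x = y}).ncard := by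
    rw [ncard_eq_toFinset_card', Finset.card_eq_sum_card_fiberwise (f := f) (t := A.toFinset)]
    · refine Finset.sum_congr rfl fun y _ => ?_
      rw [ncard_eq_toFinset_card']
      congr 1
      ext x
      simp
    · intro x hx
      simpa using hf (by simpa using hx)
  calc (S.ncard : ℝ) = ∑ y ∈ A.toFinset, (({x : α | x ∈ S ∧ f x = y}).ncard : ℝ) := by
        rw [hcard]
        push_cast
        rfl
    _ ≤ ∑ _y ∈ A.toFinset, b := Finset.sum_le_sum fun y hy => hfiber y (by simpa using hy)
    _ = A.ncard * b := by rw [Finset.sum_const, nsmul_eq_mul, ncard_eq_toFinset_card']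
    _ ≤ a * b := by gcongr

/-- if at most `μ^{1/3-2ε}` neighbours of `v` are `v`-fruitful, then there are
at most `3μ^{2/3-ε}` second neighbours `x` of `v` with `p_v(x) ∉ N^{(3)}(r)` or
`φ(n_r(p_v(x))) ≠ φ(x)`. -/
theorem stmt_6 {V : Type*} [Fintype V] (H : SimpleGraph V) (ε μ : ℝ)
    (hε : 0 < ε) (hμ : 1 ≤ μ)
    (hdeg : ∀ w : V, ((H.neighborSet w).ncard : ℝ) ≤ μ ^ ((1:ℝ)/3 + ε))
    (φ : V → Fin 3) (hφ : ∀ a b : V, H.Adj a b → φ a ≠ φ b)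
    (r : V) (nr : V → V) (hnr : ∀ a : V, H.dist r a = 3 → nr a ∈ H.neighborSet a)
    (v : V)
    (hv : ((H.neighborSet v \ {w : V | H.dist r w = 3}).ncard : ℝ) ≤ μ ^ ((1:ℝ)/3 - 2*ε))
    (p : V → V)
    (hp : ∀ x : V, H.dist v x = 2 → p x ∈ H.neighborSet v ∩ H.neighborSet x)
    -- at most `μ^{1/3-2ε}` vertices `a ∈ N(v)` are `v`-fruitful, i.e. such that the bucket
    -- `B_a = {x ∈ N^{(2)}(v) : p x = a}` contains at least `μ^{1/3-2ε}` `v`-deducing vertices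
    (hfruitful : (({a : V | a ∈ H.neighborSet v ∧
        μ ^ ((1:ℝ)/3 - 2*ε) ≤ (({x : V | (H.dist v x = 2 ∧ p x = a) ∧
          (H.dist r (p x) = 3 ∧ φ x ≠ φ (nr (p x)))}).ncard : ℝ)}).ncard : ℝ)
      ≤ μ ^ ((1:ℝ)/3 - 2*ε)) :
    (({x : V | H.dist v x = 2 ∧
        (H.dist r (p x) ≠ 3 ∨ φ (nr (p x)) ≠ φ x)}).ncard : ℝ)
      ≤ 3 * μ ^ ((2:ℝ)/3 - ε) := by
  set s : ℝ := μ ^ ((1:ℝ)/3 - 2*ε) with hs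
  set d : ℝ := μ ^ ((1:ℝ)/3 + ε) with hd
  have hμ0 : 0 < μ := by linarith
  have hs0 : 0 ≤ s := by positivity
  have hd0 : 0 ≤ d := by positivity
  have hsd : s * d = μ ^ ((2:ℝ)/3 - ε) := by
    rw [hs, hd, ← Real.rpow_add hμ0]
    congr 1
    ring
  let D : V → Set V := fun a => {x : V | (H.dist v x = 2 ∧ p x = a) ∧
    (H.dist r (p x) = 3 ∧ φ x ≠ φ (nr (p x)))}
  let F : Set V := {a : V | a ∈ H.neighborSet v ∧ s ≤ ((D a).ncard : ℝ)}
  have hF : (F.ncard : ℝ) ≤ s := hfruitful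
  let S₁ : Set V := {x | H.dist v x = 2 ∧ H.dist r (p x) ≠ 3}
  let S₂ : Set V := {x | H.dist v x = 2 ∧ p x ∈ F}
  let S₃ : Set V := {x | H.dist v x = 2 ∧ p x ∉ F ∧ H.dist r (p x) = 3 ∧ φ x ≠ φ (nr (p x))}
  have hbucket : ∀ (S : Set V), (∀ x ∈ S, H.dist v x = 2) → ∀ a,
      (({x : V | x ∈ S ∧ p x = a}).ncard : ℝ) ≤ d := by
    intro S hS a
    refine le_trans ?_ (hdeg a)
    exact_mod_cast ncard_le_ncard (by
      rintro x ⟨hx, rfl⟩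
      exact SimpleGraph.Adj.symm (hp x (hS x hx)).2) (toFinite _)
  have h₁ : (S₁.ncard : ℝ) ≤ s * d :=
    ncard_le_mul_of_fiber_le S₁ (H.neighborSet v \ {w : V | H.dist r w = 3}) p
      (fun x hx => ⟨(hp x hx.1).1, hx.2⟩) hd0 hv
      fun a _ => hbucket S₁ (fun x hx => hx.1) a
  have h₂ : (S₂.ncard : ℝ) ≤ s * d :=
    ncard_le_mul_of_fiber_le S₂ F p (fun x hx => hx.2) hd0 hF
      fun a _ => hbucket S₂ (fun x hx => hx.1) a
  have h₃ : (S₃.ncard : ℝ) ≤ d * s := by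
    refine ncard_le_mul_of_fiber_le S₃ (H.neighborSet v \ F) p
      (fun x hx => ⟨(hp x hx.1).1, hx.2.1⟩) hs0 ?_ ?_
    · refine le_trans ?_ (hdeg v)
      exact_mod_cast ncard_le_ncard sdiff_subset (toFinite _)
    · rintro a ⟨hav, haF⟩
      have hlt : ((D a).ncard : ℝ) < s := by
        by_contra! h
        exact haF ⟨hav, h⟩
      refine le_trans ?_ hlt.le
      have hsub : {x : V | x ∈ S₃ ∧ p x = a} ⊆ D a :=
        fun x hx => ⟨⟨hx.1.1, hx.2⟩, hx.1.2.2⟩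
      exact_mod_cast ncard_le_ncard hsub (toFinite _)
  have hcover : {x : V | H.dist v x = 2 ∧ (H.dist r (p x) ≠ 3 ∨ φ (nr (p x)) ≠ φ x)} ⊆
      S₁ ∪ S₂ ∪ S₃ := by
    rintro x ⟨hx, hx'⟩
    by_cases h3 : H.dist r (p x) = 3
    · by_cases hxF : p x ∈ F
      · exact Or.inl (Or.inr ⟨hx, hxF⟩)
      · exact Or.inr ⟨hx, hxF, h3, (hx'.resolve_left (not_not.mpr h3)).symm⟩
    · exact Or.inl (Or.inl ⟨hx, h3⟩)
  have hle : (({x : V | H.dist v x = 2 ∧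
      (H.dist r (p x) ≠ 3 ∨ φ (nr (p x)) ≠ φ x)}).ncard : ℝ) ≤
      S₁.ncard + S₂.ncard + S₃.ncard := by
    exact_mod_cast (ncard_le_ncard hcover (toFinite _)).trans
      ((ncard_union_le _ _).trans (Nat.add_le_add_right (ncard_union_le _ _) _))
  rw [← hsd]
  linarith [mul_comm d s]
end

section
/- Let ε ∈ (0, 1/33). There exists ℓ > 0 such that the following holds for all μ ≥ ℓ. Let H be a finite simple graph on μ vertices such that for all pairs of distinct vertices y, w ∈ V(H): |N(N(y) ∩ N(w))| ≤ μ^{1/3+ε}. Let v ∈ V(H), let A ⊆ N(v), let (B_a)_{a∈A} be a family of pairwise disjoint sets with B_a ⊆ N(a) ∩ N^{(2)}(v) and |B_a| ≥ μ^{1/3−2ε} for each a ∈ A, and let f : A → V(H) be a function with f(a) ∈ N(a) and f(a) ≠ v for all a ∈ A. If |A| ≥ μ^{1/3−5ε}/(4 log μ), then |f(A)| ≥ 4μ^{3ε} log μ. -/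
open Set

/-- If the sets `B a`, `a ∈ S`, are pairwise disjoint subsets of `T` of size at least `r`, then
`r * |S| ≤ |T|`. -/
theorem card_mul_le_ncard_of_pairwiseDisjoint {V : Type*} [Finite V] (S : Finset V) (T : Set V)
    (B : V → Set V) (r : ℝ) (hsub : ∀ a ∈ S, B a ⊆ T) (hcard : ∀ a ∈ S, r ≤ ((B a).ncard : ℝ))
    (hdisj : (S : Set V).Pairwise fun a b => Disjoint (B a) (B b)) :
    (S.card : ℝ) * r ≤ (T.ncard : ℝ) := by
  classical
  have := Fintype.ofFinite V
  have hunion : (S.biUnion fun a => (B a).toFinset).card = ∑ a ∈ S, (B a).toFinset.card :=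
    Finset.card_biUnion fun a ha b hb hab => Set.disjoint_toFinset.2 (hdisj ha hb hab)
  have hle : (S.biUnion fun a => (B a).toFinset).card ≤ T.toFinset.card :=
    Finset.card_le_card <| Finset.biUnion_subset.2 fun a ha =>
      Set.toFinset_subset_toFinset.2 (hsub a ha)
  calc (S.card : ℝ) * r = ∑ _a ∈ S, r := by simp
    _ ≤ ∑ a ∈ S, ((B a).toFinset.card : ℝ) := by
        refine Finset.sum_le_sum fun a ha => ?_
        rw [← Set.ncard_eq_toFinset_card']
        exact hcard a ha
    _ ≤ (T.ncard : ℝ) := by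
        rw [Set.ncard_eq_toFinset_card']
        exact_mod_cast hunion ▸ hle

/-- If every fibre of `f` on `A` has at most `c` elements, then `|A| ≤ |f(A)| * c`. -/
theorem ncard_le_ncard_image_mul {V : Type*} [Finite V] (A : Set V) (f : V → V)
    (c : ℝ) (hfib : ∀ w ∈ f '' A, ∀ S : Finset V, (∀ a ∈ S, a ∈ A ∧ f a = w) → (S.card : ℝ) ≤ c) :
    (A.ncard : ℝ) ≤ ((f '' A).ncard : ℝ) * c := by
  classical
  have := Fintype.ofFinite V
  have himage : (f '' A).ncard = (A.toFinset.image f).card := by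
    rw [Set.ncard_eq_toFinset_card', Set.toFinset_image]
  rw [himage, Set.ncard_eq_toFinset_card', Finset.card_eq_sum_card_image f A.toFinset]
  push_cast
  rw [← nsmul_eq_mul]
  refine Finset.sum_le_card_nsmul _ _ _ fun w hw => ?_
  refine hfib w (by simpa using hw) _ fun a ha => ?_
  simpa using ha

/-- Vertices adjacent to a common neighbour of `v` and `w`, and at distance two from `v`, lie in
the neighbourhood of the set of common neighbours. -/
theorem subset_nbhd_of_dist_eq_two {V : Type*} (H : SimpleGraph V) {v w a : V}
    (hv : H.Adj v a) (hw : H.Adj w a) :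
    H.neighborSet a ∩ {x : V | H.dist v x = 2} ⊆ nbhd H (H.neighborSet v ∩ H.neighborSet w) := by
  rintro x ⟨hax, hx⟩
  refine ⟨fun h => ?_, a, ⟨hv, hw⟩, hax⟩
  have h1 : H.dist v x = 1 := SimpleGraph.dist_eq_one_iff_adj.2 h.1
  rw [Set.mem_ofPred_eq] at hx
  omega

/-- under the common-neighbourhood expansion bound, a large family `A ⊆ N(v)`
of vertices with large pairwise disjoint buckets has a large image under any choice
function `f` with `f(a) ∈ N(a) \ {v}`. -/
theorem stmt_7 (ε : ℝ) (hε0 : 0 < ε) (hε : ε < 1/33) :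
    ∃ ℓ : ℝ, 0 < ℓ ∧
    ∀ (μ : ℕ) (V : Type) [Fintype V] (H : SimpleGraph V),
      ℓ ≤ (μ : ℝ) → Fintype.card V = μ →
      (∀ y w : V, y ≠ w →
        ((nbhd H (H.neighborSet y ∩ H.neighborSet w)).ncard : ℝ) ≤ (μ : ℝ) ^ ((1:ℝ)/3 + ε)) →
      ∀ (v : V) (A : Set V), A ⊆ H.neighborSet v →
      ∀ B : V → Set V,
        (∀ a ∈ A, B a ⊆ H.neighborSet a ∩ {x : V | H.dist v x = 2}) →
        (∀ a ∈ A, (μ : ℝ) ^ ((1:ℝ)/3 - 2*ε) ≤ ((B a).ncard : ℝ)) →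
        (A.Pairwise fun a b => Disjoint (B a) (B b)) →
      ∀ f : V → V, (∀ a ∈ A, f a ∈ H.neighborSet a ∧ f a ≠ v) →
        (μ : ℝ) ^ ((1:ℝ)/3 - 5*ε) / (4 * Real.log μ) ≤ (A.ncard : ℝ) →
        4 * (μ : ℝ) ^ (3*ε) * Real.log μ ≤ ((f '' A).ncard : ℝ) := by
  set r : ℝ := (1 / 3 - 11 * ε) / 2 with hr
  have hrpos : 0 < r := by rw [hr]; linarith
  obtain ⟨K, hK⟩ := Filter.eventually_atTop.1
    ((isLittleO_log_rpow_atTop hrpos).bound (show (0 : ℝ) < 1 / 4 by norm_num))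
  refine ⟨max K 2, by positivity, ?_⟩
  intro μ V _ H hμ _ hexp v A hA B hB hBcard hdisj f hf hAcard
  classical
  have hμ2 : (2 : ℝ) ≤ μ := (le_max_right _ _).trans hμ
  have hμ0 : (0 : ℝ) < μ := by linarith
  have hlog : 0 < Real.log μ := Real.log_pos (by linarith)
  have hlogle : Real.log μ ≤ 1 / 4 * (μ : ℝ) ^ r := by
    have h := hK μ ((le_max_left _ _).trans hμ)
    rwa [Real.norm_of_nonneg hlog.le, Real.norm_of_nonneg (by positivity)] at h
  have hfibre : ∀ w ∈ f '' A, ∀ S : Finset V, (∀ a ∈ S, a ∈ A ∧ f a = w) →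
      (S.card : ℝ) ≤ (μ : ℝ) ^ (3 * ε) := by
    rintro w ⟨a₀, ha₀, rfl⟩ S hS
    have h := card_mul_le_ncard_of_pairwiseDisjoint S
      (nbhd H (H.neighborSet v ∩ H.neighborSet (f a₀))) B ((μ : ℝ) ^ ((1 : ℝ) / 3 - 2 * ε))
      (fun a ha => (hB a (hS a ha).1).trans (subset_nbhd_of_dist_eq_two H (hA (hS a ha).1)
        ((hS a ha).2 ▸ (hf a (hS a ha).1).1.symm)))
      (fun a ha => hBcard a (hS a ha).1)
      (fun a ha b hb hab => hdisj (hS a ha).1 (hS b hb).1 hab)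
    have h' := h.trans (hexp v (f a₀) (hf a₀ ha₀).2.symm)
    rw [show (1 : ℝ) / 3 + ε = 3 * ε + (1 / 3 - 2 * ε) by ring, Real.rpow_add hμ0] at h'
    exact le_of_mul_le_mul_right h' (by positivity)
  have hcount := hAcard.trans (ncard_le_ncard_image_mul A f _ hfibre)
  have hsq : (4 * Real.log μ) * (4 * Real.log μ) ≤ (μ : ℝ) ^ r * (μ : ℝ) ^ r :=
    mul_self_le_mul_self (by positivity) (by linarith)
  have hsplit : (μ : ℝ) ^ ((1 : ℝ) / 3 - 5 * ε) =
      (μ : ℝ) ^ r * (μ : ℝ) ^ r * (μ : ℝ) ^ (3 * ε) * (μ : ℝ) ^ (3 * ε) := by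
    rw [← Real.rpow_add hμ0, ← Real.rpow_add hμ0, ← Real.rpow_add hμ0, hr]
    congr 1
    ring
  rw [div_le_iff₀ (by positivity), hsplit] at hcount
  set p : ℝ := (μ : ℝ) ^ (3 * ε)
  have hp : 0 < p := by positivity
  have hmul : (4 * p * Real.log μ) * (p * (4 * Real.log μ)) ≤
      ((f '' A).ncard : ℝ) * (p * (4 * Real.log μ)) := by
    calc _ = (4 * Real.log μ) * (4 * Real.log μ) * (p * p) := by ring
      _ ≤ (μ : ℝ) ^ r * (μ : ℝ) ^ r * (p * p) := by gcongr
      _ = (μ : ℝ) ^ r * (μ : ℝ) ^ r * p * p := by ring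
      _ ≤ _ := by rw [← mul_assoc]; exact hcount
  exact le_of_mul_le_mul_right hmul (by positivity)
end
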